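/- For every natural number n, every polynomial P ∈ ℂ[X] of degree at most n, and every real number t with −1 ≤ t ≤ 1, one has |P(t)| ≤ (n+1) · ( (1/2) ∫_{−1}^{1} |P(s)|² ds )^{1/2}. That is, the filtration of (C([−1,1]), normalized Lebesgue measure) by polynomials of degree at most n has the rapid decay property, with constant c = 1 and exponent α = 1. -/

import Mathlib

open Polynomial in
/-- Legendre polynomials, by Bonnet's recursion. -/
noncomputable def legP : ℕ → Polynomial ℝ
  | 0 => 1
  | 1 => X
  | (k + 2) => C (1 / ((k : ℝ) + 2)) *
      (C (2 * (k : ℝ) + 3) * X * legP (k + 1) - C ((k : ℝ) + 1) * legP k)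

open Polynomial in
theorem legP_rec (k : ℕ) : C ((k : ℝ) + 2) * legP (k + 2) =
    C (2 * (k : ℝ) + 3) * X * legP (k + 1) - C ((k : ℝ) + 1) * legP k := by
  rw [legP, ← mul_assoc, ← C_mul]
  have : ((k : ℝ) + 2) * (1 / ((k : ℝ) + 2)) = 1 := by
    field_simp
  rw [this, C_1, one_mul]

open Polynomial in
theorem legP_AB (k : ℕ) :
    derivative (legP (k + 1)) = X * derivative (legP k) + C ((k : ℝ) + 1) * legP k ∧
    X * derivative (legP (k + 1)) - derivative (legP k) = C ((k : ℝ) + 1) * legP (k + 1) := by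
  induction k with
  | zero => simp [legP]
  | succ k ih =>
    obtain ⟨hA, hB⟩ := ih
    have hr := legP_rec k
    have hd := congrArg derivative hr
    simp only [derivative_mul, derivative_sub, derivative_C, derivative_X, zero_mul, zero_add,
      mul_one] at hd
    have h0 : (C ((k : ℝ) + 2) : Polynomial ℝ) ≠ 0 := by
      rw [Ne, C_eq_zero]; positivity
    have e1 : (C (2 * (k : ℝ) + 3) : Polynomial ℝ) = 2 * C (k : ℝ) + 3 := by
      rw [C_add, C_mul, (map_ofNat C 2 : (C (2 : ℝ) : Polynomial ℝ) = 2),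
        (map_ofNat C 3 : (C (3 : ℝ) : Polynomial ℝ) = 3)]
    have e2 : (C ((k : ℝ) + 2) : Polynomial ℝ) = C (k : ℝ) + 2 := by
      rw [C_add, (map_ofNat C 2 : (C (2 : ℝ) : Polynomial ℝ) = 2)]
    have e3 : (C ((k : ℝ) + 1) : Polynomial ℝ) = C (k : ℝ) + 1 := by simp
    have e4 : (C (((k + 1 : ℕ) : ℝ) + 1) : Polynomial ℝ) = C (k : ℝ) + 2 := by
      rw [← e2]; congr 1; push_cast; ring
    rw [e4]
    rw [e1, e2, e3] at hr hd
    rw [e3] at hA hB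
    rw [e2] at h0
    have A2 : derivative (legP (k + 1 + 1)) = X * derivative (legP (k + 1)) +
        (C (k : ℝ) + 2) * legP (k + 1) := by
      apply mul_left_cancel₀ h0
      linear_combination hd + (C (k : ℝ) + 1) * hB
    refine ⟨A2, ?_⟩
    linear_combination X * A2 - hr + X * hB - hA

open Polynomial in
theorem legP_ode (k : ℕ) : derivative ((X ^ 2 - 1) * derivative (legP k)) =
    C ((k : ℝ) * (k + 1)) * legP k := by
  cases k with
  | zero => simp [legP]
  | succ k =>
    obtain ⟨hA, hB⟩ := legP_AB k
    have hC : (X ^ 2 - 1) * derivative (legP (k + 1)) =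
        C ((k : ℝ) + 1) * (X * legP (k + 1) - legP k) := by
      linear_combination X * hB - hA
    rw [hC]
    simp only [derivative_mul, derivative_sub, derivative_C, derivative_X, zero_mul, zero_add,
      one_mul]
    have e3 : (C (((k + 1 : ℕ) : ℝ) * (((k + 1 : ℕ) : ℝ) + 1)) : Polynomial ℝ)
      = C ((k : ℝ) + 1) * (C ((k : ℝ) + 1) + 1) := by
      rw [C_mul]; congr 1 <;> simp
    rw [e3]
    linear_combination C ((k : ℝ) + 1) * hB

theorem legP_one (k : ℕ) : (legP k).eval 1 = 1 ∧ (legP (k + 1)).eval 1 = 1 := by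
  induction k with
  | zero => simp [legP]
  | succ k ih =>
    refine ⟨ih.2, ?_⟩
    have h := congrArg (Polynomial.eval 1) (legP_rec k)
    simp [ih.1, ih.2] at h
    have h0 : (k : ℝ) + 2 ≠ 0 := by positivity
    apply mul_left_cancel₀ h0
    linear_combination h

theorem legP_neg_one (k : ℕ) : (legP k).eval (-1) = (-1) ^ k ∧
    (legP (k + 1)).eval (-1) = (-1) ^ (k + 1) := by
  induction k with
  | zero => simp [legP]
  | succ k ih =>
    refine ⟨ih.2, ?_⟩
    have h := congrArg (Polynomial.eval (-1)) (legP_rec k)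
    simp [ih.1, ih.2] at h
    have h0 : (k : ℝ) + 2 ≠ 0 := by positivity
    apply mul_left_cancel₀ h0
    linear_combination h

open Polynomial in
theorem legP_bound (k : ℕ) (t : ℝ) (ht : t ∈ Set.Icc (-1 : ℝ) 1) : |(legP k).eval t| ≤ 1 := by
  rcases Nat.eq_zero_or_pos k with rfl | hk
  · simp [legP]
  set m : ℝ := (k : ℝ) * (k + 1) with hm
  have hmpos : 0 < m := by positivity
  set p := legP k with hp
  set f : Polynomial ℝ := C m * p ^ 2 - (X ^ 2 - 1) * derivative p ^ 2 with hf
  have hfd : derivative f = 2 * X * derivative p ^ 2 := by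
    have h := legP_ode k
    rw [← hm, ← hp] at h
    simp [derivative_pow] at h
    simp [hf, derivative_pow]
    have c2 := (map_ofNat C 2 : (C (2 : ℝ) : Polynomial ℝ) = 2)
    rw [c2] at h ⊢
    linear_combination -2 * derivative p * h
  have hev : ∀ x, f.eval x = m * p.eval x ^ 2 + (1 - x ^ 2) * (derivative p).eval x ^ 2 := by
    intro x; simp [hf]; ring
  have hdv : ∀ x, deriv (fun y => f.eval y) x = 2 * x * (derivative p).eval x ^ 2 := by
    intro x; rw [Polynomial.deriv, hfd]; simp
  have key : f.eval t ≤ m := by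
    rcases le_total 0 t with h | h
    · have hmono : MonotoneOn (fun y => f.eval y) (Set.Icc 0 1) := by
        apply monotoneOn_of_deriv_nonneg (convex_Icc 0 1) f.continuous.continuousOn
          f.differentiable.differentiableOn
        intro x hx
        rw [interior_Icc] at hx
        rw [hdv]
        have := hx.1
        positivity
      have := hmono ⟨h, ht.2⟩ (Set.right_mem_Icc.2 zero_le_one) ht.2
      simp only at this
      rw [hev 1, hp, (legP_one k).1] at this
      linarith
    · have hmono : AntitoneOn (fun y => f.eval y) (Set.Icc (-1) 0) := by
        apply antitoneOn_of_deriv_nonpos (convex_Icc (-1) 0) f.continuous.continuousOn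
          f.differentiable.differentiableOn
        intro x hx
        rw [interior_Icc] at hx
        rw [hdv]
        have := hx.2
        exact mul_nonpos_of_nonpos_of_nonneg (by linarith) (sq_nonneg _)
      have := hmono (Set.left_mem_Icc.2 (by norm_num)) ⟨ht.1, h⟩ ht.1
      simp only at this
      rw [hev (-1), hp, (legP_neg_one k).1, ← pow_mul, mul_comm k 2, pow_mul] at this
      norm_num at this
      linarith
  rw [hev] at key
  have h1 : 0 ≤ (1 - t ^ 2) * (derivative p).eval t ^ 2 :=
    mul_nonneg (by nlinarith [ht.1, ht.2]) (sq_nonneg _)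
  have h2 : p.eval t ^ 2 ≤ 1 := by
    by_contra hc
    push Not at hc
    nlinarith
  exact (sq_le_one_iff_abs_le_one _).1 h2

/-- Integration over `[-1,1]` as a linear functional. -/
noncomputable def legL : Polynomial ℝ →ₗ[ℝ] ℝ where
  toFun p := ∫ s in (-1 : ℝ)..1, p.eval s
  map_add' p q := by
    simp only [Polynomial.eval_add]
    exact intervalIntegral.integral_add (p.continuous.intervalIntegrable _ _)
      (q.continuous.intervalIntegrable _ _)
  map_smul' c p := by
    simp [Polynomial.eval_smul]

theorem legL_apply (p : Polynomial ℝ) : legL p = ∫ s in (-1 : ℝ)..1, p.eval s := rfl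

theorem legL_C_mul (c : ℝ) (p : Polynomial ℝ) : legL (Polynomial.C c * p) = c * legL p := by
  rw [← Polynomial.smul_eq_C_mul, map_smul, smul_eq_mul]

theorem legL_deriv (p : Polynomial ℝ) :
    legL (Polynomial.derivative p) = p.eval 1 - p.eval (-1) := by
  rw [legL_apply]
  refine intervalIntegral.integral_eq_sub_of_hasDerivAt (f := fun x => p.eval x)
    (f' := fun x => (Polynomial.derivative p).eval x) ?_ ?_
  · intro x _
    exact p.hasDerivAt x
  · exact (Polynomial.continuous _).intervalIntegrable _ _

open Polynomial in
theorem legP_orth {i j : ℕ} (h : i ≠ j) : legL (legP i * legP j) = 0 := by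
  have hi := legP_ode i
  have hj := legP_ode j
  have hd : derivative ((X ^ 2 - 1) * (legP i * derivative (legP j) - legP j * derivative (legP i)))
      = C ((j : ℝ) * (j + 1) - i * (i + 1)) * (legP i * legP j) := by
    rw [C_sub]
    simp only [derivative_mul, derivative_sub] at hi hj ⊢
    linear_combination legP i * hj - legP j * hi
  have h2 := legL_deriv ((X ^ 2 - 1) * (legP i * derivative (legP j) - legP j * derivative (legP i)))
  rw [hd, legL_C_mul] at h2
  simp at h2
  rcases h2 with h2 | h2
  · exfalso
    have h3 : ((j : ℝ) - i) * (j + i + 1) = 0 := by linear_combination h2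
    rcases mul_eq_zero.1 h3 with h4 | h4
    · exact h (by exact_mod_cast (sub_eq_zero.1 h4).symm)
    · have : (0 : ℝ) < j + i + 1 := by positivity
      linarith
  · exact h2

open Polynomial in
theorem legP_norm (k : ℕ) : legL (legP k * legP k) = 2 / (2 * k + 1) ∧
    legL (legP (k + 1) * legP (k + 1)) = 2 / (2 * k + 3) := by
  induction k with
  | zero =>
    constructor
    · simp [legP, legL_apply]; norm_num
    · simp [legP, legL_apply, ← pow_two]; norm_num
  | succ k ih =>
    refine ⟨by rw [ih.2]; push_cast; ring, ?_⟩
    have h1 := legP_rec k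
    have h2 := legP_rec (k + 1)
    have a1 := congrArg legL (congrArg (· * legP (k + 2)) h1)
    have a2 := congrArg legL (congrArg (· * legP (k + 1)) h2)
    simp only [sub_mul, map_sub, mul_assoc, legL_C_mul] at a1 a2
    rw [legP_orth (show k ≠ k + 2 by omega)] at a1
    rw [show k + 1 + 2 = k + 3 from rfl, legP_orth (show k + 3 ≠ k + 1 by omega),
      show k + 1 + 1 = k + 2 from rfl, ih.2, mul_comm (legP (k+2)) (legP (k+1))] at a2
    push_cast at a1 a2 ⊢
    have hk : (0 : ℝ) ≤ k := Nat.cast_nonneg k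
    rw [show k + 1 + 1 = k + 2 from rfl]
    have b : legL (X * (legP (k + 1) * legP (k + 2))) =
        ((k : ℝ) + 2) * (2 / (2 * k + 3)) / (2 * k + 5) := by
      rw [eq_div_iff (by positivity)]
      linear_combination -a2
    rw [b] at a1
    have h0 : (k : ℝ) + 2 ≠ 0 := by positivity
    apply mul_left_cancel₀ h0
    rw [a1]
    field_simp
    ring

theorem legP_natDegree (k : ℕ) : (legP k).natDegree ≤ k ∧ (legP (k + 1)).natDegree ≤ k + 1 := by
  induction k with
  | zero => simp [legP]
  | succ k ih =>
    refine ⟨ih.2, ?_⟩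
    rw [legP]
    refine (Polynomial.natDegree_C_mul_le _ _).trans ?_
    refine (Polynomial.natDegree_sub_le _ _).trans (max_le ?_ ?_)
    · rw [mul_assoc]
      refine (Polynomial.natDegree_C_mul_le _ _).trans ?_
      refine Polynomial.natDegree_mul_le.trans ?_
      rw [Polynomial.natDegree_X]
      omega
    · refine (Polynomial.natDegree_C_mul_le _ _).trans ?_
      omega

theorem legP_coeff (k : ℕ) : (legP k).coeff k ≠ 0 ∧ (legP (k + 1)).coeff (k + 1) ≠ 0 := by
  induction k with
  | zero => simp [legP]
  | succ k ih =>
    refine ⟨ih.2, ?_⟩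
    have h := congrArg (fun p => Polynomial.coeff p (k + 2)) (legP_rec k)
    simp only [mul_assoc, Polynomial.coeff_C_mul, Polynomial.coeff_sub,
      Polynomial.coeff_X_mul] at h
    rw [Polynomial.coeff_eq_zero_of_natDegree_lt
      (show (legP k).natDegree < k + 2 by have := (legP_natDegree k).1; omega)] at h
    intro h0
    rw [show k + 1 + 1 = k + 2 from rfl] at h0
    rw [h0] at h
    have h3 : (2 * (k : ℝ) + 3) ≠ 0 := by positivity
    have := mul_ne_zero h3 ih.2
    apply this
    linear_combination -h

theorem legP_expand (n : ℕ) : ∀ P : Polynomial ℝ, P.natDegree < n →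
    ∃ c : ℕ → ℝ, P = ∑ k ∈ Finset.range n, Polynomial.C (c k) * legP k := by
  induction n with
  | zero => intro P h; omega
  | succ n ih =>
    intro P hP
    set a := P.coeff n / (legP n).coeff n with ha
    set Q := P - Polynomial.C a * legP n with hQ
    have hn := (legP_natDegree n).1
    have hQd : Q.natDegree ≤ n := by
      refine (Polynomial.natDegree_sub_le _ _).trans (max_le (by omega) ?_)
      exact (Polynomial.natDegree_C_mul_le _ _).trans hn
    have hQc : Q.coeff n = 0 := by
      rw [hQ, Polynomial.coeff_sub, Polynomial.coeff_C_mul, ha,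
        div_mul_cancel₀ _ (legP_coeff n).1, sub_self]
    have : ∃ c : ℕ → ℝ, Q = ∑ k ∈ Finset.range n, Polynomial.C (c k) * legP k := by
      by_cases hQ0 : Q = 0
      · exact ⟨fun _ => 0, by simp [hQ0]⟩
      · apply ih
        refine lt_of_le_of_ne hQd fun he => hQ0 ?_
        rw [← he] at hQc
        exact Polynomial.leadingCoeff_eq_zero.1 hQc
    obtain ⟨c, hc⟩ := this
    refine ⟨fun k => if k = n then a else c k, ?_⟩
    rw [Finset.sum_range_succ]
    simp only [if_true]
    rw [Finset.sum_congr rfl (g := fun k => Polynomial.C (c k) * legP k), ← hc, hQ]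
    · ring
    · intro k hk
      simp only [if_neg (Finset.mem_range.1 hk).ne]

theorem legP_sum_odd (n : ℕ) : ∑ k ∈ Finset.range n, (2 * (k : ℝ) + 1) = (n : ℝ) ^ 2 := by
  induction n with
  | zero => simp
  | succ n ih => rw [Finset.sum_range_succ, ih]; push_cast; ring

theorem legP_real (n : ℕ) (R : Polynomial ℝ) (hR : R.natDegree ≤ n) (t : ℝ)
    (ht : t ∈ Set.Icc (-1 : ℝ) 1) :
    R.eval t ^ 2 ≤ ((n : ℝ) + 1) ^ 2 * ((1 / 2) * ∫ s in (-1 : ℝ)..1, R.eval s ^ 2) := by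
  obtain ⟨c, hc⟩ := legP_expand (n + 1) R (by omega)
  have hI : ∫ s in (-1 : ℝ)..1, R.eval s ^ 2 =
      ∑ k ∈ Finset.range (n + 1), c k ^ 2 * (2 / (2 * (k : ℝ) + 1)) := by
    have : ∫ s in (-1 : ℝ)..1, R.eval s ^ 2 = legL (R * R) := by
      rw [legL_apply]; simp [pow_two]
    rw [this]
    conv_lhs => rw [hc]
    rw [Finset.sum_mul_sum, map_sum]
    refine Finset.sum_congr rfl fun i hi => ?_
    rw [map_sum, Finset.sum_eq_single i]
    · rw [mul_mul_mul_comm, ← Polynomial.C_mul, legL_C_mul, (legP_norm i).1]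
      ring
    · intro j _ hj
      rw [mul_mul_mul_comm, ← Polynomial.C_mul, legL_C_mul, legP_orth hj.symm, mul_zero]
    · intro h; exact absurd hi h
  have hE : R.eval t = ∑ k ∈ Finset.range (n + 1), c k * (legP k).eval t := by
    conv_lhs => rw [hc]
    simp [Polynomial.eval_finsetSum]
  have hCS := Finset.sum_sq_le_sum_mul_sum_of_sq_le_mul (Finset.range (n + 1))
    (r := fun k => c k * (legP k).eval t) (f := fun k => 2 * (k : ℝ) + 1)
    (g := fun k => c k ^ 2 / (2 * (k : ℝ) + 1)) (fun k _ => by positivity)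
    (fun k _ => by positivity) (fun k _ => by
      have h1 : (2 * (k : ℝ) + 1) * (c k ^ 2 / (2 * (k : ℝ) + 1)) = c k ^ 2 := by
        field_simp
      rw [h1, mul_pow]
      have h2 := (sq_le_one_iff_abs_le_one _).2 (legP_bound k t ht)
      exact mul_le_of_le_one_right (sq_nonneg _) h2)
  rw [legP_sum_odd] at hCS
  rw [hE, hI, Finset.mul_sum]
  push_cast at hCS
  refine hCS.trans (le_of_eq ?_)
  congr 1
  refine Finset.sum_congr rfl fun k _ => ?_
  ring

/-- Rapid decay for normalized Lebesgue measure on `[-1, 1]`: for every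
polynomial `P ∈ ℂ[X]` of degree at most `n` and every `t ∈ [-1, 1]`,
`|P(t)| ≤ (n+1) ((1/2) ∫_{-1}^{1} |P(s)|² ds)^{1/2}`. -/
theorem lebesgue_polynomial_rapidDecay (n : ℕ) (P : Polynomial ℂ)
    (hP : P.degree ≤ (n : ℕ)) (t : ℝ) (ht : t ∈ Set.Icc (-1 : ℝ) 1) :
    ‖P.eval (t : ℂ)‖ ≤ ((n : ℝ) + 1) *
      Real.sqrt ((1 / 2) * ∫ s in (-1 : ℝ)..1, ‖P.eval (s : ℂ)‖ ^ 2) := by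
  obtain ⟨u, hu, hut⟩ : ∃ u : ℂ, ‖u‖ = 1 ∧ u * P.eval (t : ℂ) = (‖P.eval (t : ℂ)‖ : ℂ) := by
    by_cases h : P.eval (t : ℂ) = 0
    · exact ⟨1, by simp, by simp [h]⟩
    · refine ⟨(‖P.eval (t : ℂ)‖ : ℂ) / P.eval (t : ℂ), ?_, div_mul_cancel₀ _ h⟩
      rw [norm_div, Complex.norm_real, norm_norm, div_self (norm_ne_zero_iff.2 h)]
  have hPn : P.natDegree ≤ n := Polynomial.natDegree_le_of_degree_le hP
  set R : Polynomial ℝ := ∑ i ∈ Finset.range (n + 1),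
    Polynomial.C ((u * P.coeff i).re) * Polynomial.X ^ i with hRdef
  have hRd : R.natDegree ≤ n := by
    apply Polynomial.natDegree_sum_le_of_forall_le
    intro i hi
    refine (Polynomial.natDegree_C_mul_X_pow_le _ _).trans ?_
    have := Finset.mem_range.1 hi
    omega
  have hRe : ∀ s : ℝ, R.eval s = (u * P.eval (s : ℂ)).re := by
    intro s
    rw [Polynomial.eval_eq_sum_range' (Nat.lt_succ_of_le hPn), Finset.mul_sum, Complex.re_sum,
      hRdef, Polynomial.eval_finsetSum]
    refine Finset.sum_congr rfl fun i _ => ?_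
    rw [← mul_assoc, ← Complex.ofReal_pow, Complex.re_mul_ofReal]
    simp
  have h1 := legP_real n R hRd t ht
  rw [hRe t, hut, Complex.ofReal_re] at h1
  have h2 : ∫ s in (-1 : ℝ)..1, R.eval s ^ 2 ≤ ∫ s in (-1 : ℝ)..1, ‖P.eval (s : ℂ)‖ ^ 2 := by
    apply intervalIntegral.integral_mono_on (by norm_num)
    · exact (R.continuous.pow 2).intervalIntegrable _ _
    · exact (((P.continuous.comp Complex.continuous_ofReal).norm).pow 2).intervalIntegrable _ _
    · intro s _
      have h3 : |R.eval s| ≤ ‖P.eval (s : ℂ)‖ := by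
        rw [hRe]
        refine (Complex.abs_re_le_norm _).trans ?_
        rw [norm_mul, hu, one_mul]
      rw [← sq_abs]
      gcongr
  have hn : (0 : ℝ) ≤ (n : ℝ) + 1 := by positivity
  calc ‖P.eval (t : ℂ)‖ ≤ Real.sqrt (((n : ℝ) + 1) ^ 2 *
        ((1 / 2) * ∫ s in (-1 : ℝ)..1, ‖P.eval (s : ℂ)‖ ^ 2)) := by
        apply Real.le_sqrt_of_sq_le
        refine h1.trans ?_
        gcongr
    _ = _ := by rw [Real.sqrt_mul (sq_nonneg _), Real.sqrt_sq hn]
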